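/- Let (α, β, σ, λ, μ) with Frenet apparatuses (T, N, B, κ, τ; ε₁, ε₂) and (T̃, Ñ, B̃, κ̃, τ̃; ε̃₁, ε̃₂) form a non-null Mannheim pair satisfying the real-angle hypothesis (Case 3) with angle function φ. Then for all s ∈ ℝ: (vii) cos(φ(s))² = 1 − λ(σ(s))·μ·κ(s), and (viii) sin(φ(s))² = λ(σ(s))²·μ·τ(s)·τ̃(σ(s)). -/

import Mathlib

noncomputable def mink (x y : Fin 3 → ℝ) : ℝ :=
  -(x 0 * y 0) + x 1 * y 1 + x 2 * y 2

/-- A Frenet apparatus with signs `(ε₁, ε₂)` for a smooth curve `γ : ℝ → ℝ³`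
in Minkowski 3-space. -/
structure FrenetApparatus (γ T N B : ℝ → Fin 3 → ℝ) (κ τ : ℝ → ℝ) (ε₁ ε₂ : ℝ) : Prop where
  smooth_curve : ContDiff ℝ (⊤ : ℕ∞) γ
  smooth_T : ContDiff ℝ (⊤ : ℕ∞) T
  smooth_N : ContDiff ℝ (⊤ : ℕ∞) N
  smooth_B : ContDiff ℝ (⊤ : ℕ∞) B
  smooth_curv : ContDiff ℝ (⊤ : ℕ∞) κ
  smooth_tors : ContDiff ℝ (⊤ : ℕ∞) τ
  sign1 : ε₁ = 1 ∨ ε₁ = -1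
  sign2 : ε₂ = 1 ∨ ε₂ = -1
  tangent : ∀ s, T s = deriv γ s
  inner_TT : ∀ s, mink (T s) (T s) = ε₁
  inner_NN : ∀ s, mink (N s) (N s) = ε₂
  inner_BB : ∀ s, mink (B s) (B s) = -ε₂
  inner_TN : ∀ s, mink (T s) (N s) = 0
  inner_TB : ∀ s, mink (T s) (B s) = 0
  inner_NB : ∀ s, mink (N s) (B s) = 0
  frenet_T : ∀ s, deriv T s = κ s • N s
  frenet_N : ∀ s, deriv N s = (-(ε₁ * ε₂) * κ s) • T s + τ s • B s
  frenet_B : ∀ s, deriv B s = (ε₁ * τ s) • N s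

/-- A non-null Mannheim pair `(α, β, σ, λ, μ)` together with Frenet apparatuses
`(T, N, B, κ, τ; ε₁, ε₂)` of `α` and `(T', N', B', κ', τ'; ε₁', ε₂')` of `β`. -/
structure MannheimPair (α β T N B : ℝ → Fin 3 → ℝ) (κ τ : ℝ → ℝ) (ε₁ ε₂ : ℝ)
    (T' N' B' : ℝ → Fin 3 → ℝ) (κ' τ' : ℝ → ℝ) (ε₁' ε₂' : ℝ)
    (σ lam : ℝ → ℝ) (μ : ℝ) : Prop where
  frenet_fst : FrenetApparatus α T N B κ τ ε₁ ε₂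
  frenet_snd : FrenetApparatus β T' N' B' κ' τ' ε₁' ε₂'
  smooth_repar : ContDiff ℝ (⊤ : ℕ∞) σ
  surj_repar : Function.Surjective σ
  deriv_repar_pos : ∀ s, 0 < deriv σ s
  smooth_lam : ContDiff ℝ (⊤ : ℕ∞) lam
  sign_mu : μ = 1 ∨ μ = -1
  mannheim_eq : ∀ s, α s = β (σ s) + lam (σ s) • B' (σ s)
  binormal_eq : ∀ s, B' (σ s) = μ • N s

/-- The hyperbolic-angle hypothesis relating the frames of a non-null Mannheim pair. -/
def HypAngle (T B T' N' : ℝ → Fin 3 → ℝ) (σ φ : ℝ → ℝ) : Prop :=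
  ContDiff ℝ (⊤ : ℕ∞) φ ∧
  (∀ s, T s = Real.cosh (φ s) • T' (σ s) + Real.sinh (φ s) • N' (σ s)) ∧
  (∀ s, B s = Real.sinh (φ s) • T' (σ s) + Real.cosh (φ s) • N' (σ s))

/-- The real-angle hypothesis (Case 3) relating the frames of a non-null Mannheim pair. -/
def RealAngle (T B T' N' : ℝ → Fin 3 → ℝ) (σ φ : ℝ → ℝ) : Prop :=
  ContDiff ℝ (⊤ : ℕ∞) φ ∧
  (∀ s, T s = Real.cos (φ s) • T' (σ s) + Real.sin (φ s) • N' (σ s)) ∧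
  (∀ s, B s = -Real.sin (φ s) • T' (σ s) + Real.cos (φ s) • N' (σ s))

theorem mink_comm (x y : Fin 3 → ℝ) : mink x y = mink y x := by
  simp only [mink]; ring

theorem mink_add_left (x y z : Fin 3 → ℝ) : mink (x + y) z = mink x z + mink y z := by
  simp only [mink, Pi.add_apply]; ring

theorem mink_smul_left (a : ℝ) (x z : Fin 3 → ℝ) : mink (a • x) z = a * mink x z := by
  simp only [mink, Pi.smul_apply, smul_eq_mul]; ring

/-- The tangent of the first curve of a Mannheim pair in the frame of the second one. -/
theorem MannheimPair.tangent_eq {α β T N B T' N' B' : ℝ → Fin 3 → ℝ}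
    {κ τ κ' τ' σ lam : ℝ → ℝ} {ε₁ ε₂ ε₁' ε₂' μ : ℝ}
    (h : MannheimPair α β T N B κ τ ε₁ ε₂ T' N' B' κ' τ' ε₁' ε₂' σ lam μ) (s : ℝ) :
    T s = deriv σ s • T' (σ s) + ((deriv lam (σ s) * deriv σ s) • B' (σ s) +
      (lam (σ s) * (deriv σ s * (ε₁' * τ' (σ s)))) • N' (σ s)) := by
  have hσ := (h.smooth_repar.differentiable (by simp) s).hasDerivAt
  have hβ := (h.frenet_snd.smooth_curve.differentiable (by simp) (σ s)).hasDerivAt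
  have hB := (h.frenet_snd.smooth_B.differentiable (by simp) (σ s)).hasDerivAt
  have hl := (h.smooth_lam.differentiable (by simp) (σ s)).hasDerivAt
  rw [← h.frenet_snd.tangent] at hβ
  rw [h.frenet_snd.frenet_B] at hB
  have hsum := (hβ.scomp s hσ).add ((hl.comp s hσ).smul (hB.scomp s hσ))
  have hα : α = β ∘ σ + (lam ∘ σ) • (B' ∘ σ) := funext h.mannheim_eq
  rw [h.frenet_fst.tangent, hα, hsum.deriv]
  simp only [Function.comp_apply, smul_smul]
  module

/-- The derivative of the common normal direction of a Mannheim pair, in both frames. -/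
theorem MannheimPair.deriv_binormal_eq {α β T N B T' N' B' : ℝ → Fin 3 → ℝ}
    {κ τ κ' τ' σ lam : ℝ → ℝ} {ε₁ ε₂ ε₁' ε₂' μ : ℝ}
    (h : MannheimPair α β T N B κ τ ε₁ ε₂ T' N' B' κ' τ' ε₁' ε₂' σ lam μ) (s : ℝ) :
    (deriv σ s * (ε₁' * τ' (σ s))) • N' (σ s) =
      (μ * (-(ε₁ * ε₂) * κ s)) • T s + (μ * τ s) • B s := by
  have hσ := (h.smooth_repar.differentiable (by simp) s).hasDerivAt
  have hB := (h.frenet_snd.smooth_B.differentiable (by simp) (σ s)).hasDerivAt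
  have hN := (h.frenet_fst.smooth_N.differentiable (by simp) s).hasDerivAt
  rw [h.frenet_snd.frenet_B] at hB
  rw [h.frenet_fst.frenet_N] at hN
  have hcomp : B' ∘ σ = μ • N := funext h.binormal_eq
  have hleft := hB.scomp s hσ
  rw [hcomp] at hleft
  have heq := hleft.unique (hN.const_smul μ)
  simpa only [smul_smul, smul_add] using heq

/-- Case 3: Lemma 1 (vii) and (viii). -/
theorem mannheim_case3_relations_vii_viii
    (α β T N B T' N' B' : ℝ → Fin 3 → ℝ) (κ τ κ' τ' σ lam φ : ℝ → ℝ)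
    (ε₁ ε₂ ε₁' ε₂' μ : ℝ)
    (hpair : MannheimPair α β T N B κ τ ε₁ ε₂ T' N' B' κ' τ' ε₁' ε₂' σ lam μ)
    (hε₁ : ε₁ = 1) (hε₂ : ε₂ = -1) (hε₁' : ε₁' = 1) (hε₂' : ε₂' = 1)
    (hangle : RealAngle T B T' N' σ φ) :
    ∀ s, Real.cos (φ s) ^ 2 = 1 - lam (σ s) * μ * κ s ∧
      Real.sin (φ s) ^ 2 = lam (σ s) ^ 2 * μ * τ s * τ' (σ s) := by
  subst hε₁ hε₂ hε₁' hε₂'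
  intro s
  obtain ⟨-, hT, hB⟩ := hangle
  have hF := hpair.frenet_snd
  have hTT := hF.inner_TT (σ s)
  have hNN := hF.inner_NN (σ s)
  have hTN := hF.inner_TN (σ s)
  have hNT := (mink_comm _ _).trans hTN
  have hBT := (mink_comm _ _).trans (hF.inner_TB (σ s))
  have hBN := (mink_comm _ _).trans (hF.inner_NB (σ s))
  have ht := hpair.tangent_eq s
  have hb := hpair.deriv_binormal_eq s
  rw [hT s] at ht
  rw [hT s, hB s] at hb
  have hcos := congrArg (mink · (T' (σ s))) ht
  have hsin := congrArg (mink · (N' (σ s))) ht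
  have hbT := congrArg (mink · (T' (σ s))) hb
  have hbN := congrArg (mink · (N' (σ s))) hb
  simp only [mink_add_left, mink_smul_left, hTT, hNN, hTN, hNT, hBT, hBN] at hcos hsin hbT hbN
  have hone := Real.sin_sq_add_cos_sq (φ s)
  generalize Real.cos (φ s) = c at *
  generalize Real.sin (φ s) = d at *
  generalize deriv σ s = v at *
  have hc : c = v := by linarith
  have hd : d = lam (σ s) * v * τ' (σ s) := by linarith
  have hκ : μ * κ s = v * τ' (σ s) * d := by
    linear_combination (-c) * hbT - d * hbN - μ * κ s * hone
  have hτ : μ * τ s = v * τ' (σ s) * c := by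
    linear_combination d * hbT - c * hbN - μ * τ s * hone
  constructor
  · linear_combination hone - d * hd + lam (σ s) * hκ
  · linear_combination (d + lam (σ s) * v * τ' (σ s)) * hd - lam (σ s) ^ 2 * τ' (σ s) * hτ -
      lam (σ s) ^ 2 * τ' (σ s) ^ 2 * v * hc
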